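/- Assume G is connected, G[supp μ] is not connected, supp μ ≠ S, and N ≥ 3, and let c_N = 1/(2(N−1)^2). Then for every integer ℓ > k̄ and for every probability distribution ϑ on S (viewed as a row vector), ||ϑ (P^{(μ_ℓ,G)})^{ℓ^{2N}} − μ_ℓ||_TV ≤ exp( −c_N^{N−1} ⌊ ℓ^{N+1} / (N−1) ⌋ ). -/

import Mathlib

open Finset

attribute [local instance] Classical.propDecidable

/-- Total variation distance between two distributions on a finite set. -/
noncomputable def tvDist {S : Type*} [Fintype S] (a b : S → ℝ) : ℝ :=
  (1 / 2) * ∑ s, |a s - b s|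

/-- `k̄ = ⌈1 / min{μ(s) : s ∈ S, μ(s) > 0}⌉`. -/
noncomputable def suppMinCeil {N : ℕ} (μ : Fin N → ℝ) : ℕ :=
  ⌈1 / sInf (μ '' {s | 0 < μ s})⌉₊

/-- `A_k = {s ∈ S : μ(s) < 1/k}`. -/
noncomputable def Ak {N : ℕ} (μ : Fin N → ℝ) (k : ℕ) : Finset (Fin N) :=
  Finset.univ.filter fun s => μ s < 1 / (k : ℝ)

/-- `η_k`, the uniform distribution on `A_k`. -/
noncomputable def etak {N : ℕ} (μ : Fin N → ℝ) (k : ℕ) : Fin N → ℝ :=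
  fun s => if s ∈ Ak μ k then 1 / ((Ak μ k).card : ℝ) else 0

/-- `μ_k = (1/k) η_k + ((k-1)/k) μ`. -/
noncomputable def muk {N : ℕ} (μ : Fin N → ℝ) (k : ℕ) : Fin N → ℝ :=
  fun s => (1 / (k : ℝ)) * etak μ k s + (((k : ℝ) - 1) / k) * μ s

/-- The denominator appearing in the definition of the constant `p`:
`Σ_{m>l} 1_{{s^l,s^m} ∈ E} + Σ_{m<l} (ν(s^m)/ν(s^l)) 1_{{s^l,s^m} ∈ E}`. -/
noncomputable def denomP {V : Type*} [Fintype V] [LinearOrder V]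
    (G : SimpleGraph V) (ν : V → ℝ) (l : V) : ℝ :=
  (∑ m, if l < m ∧ G.Adj l m then (1 : ℝ) else 0)
    + ∑ m, if m < l ∧ G.Adj l m then ν m / ν l else 0

/-- The constant `p = min_l 1/(2 · denom(l))`. -/
noncomputable def pconst {V : Type*} [Fintype V] [LinearOrder V]
    (G : SimpleGraph V) (ν : V → ℝ) : ℝ :=
  ⨅ l, 1 / (2 * denomP G ν l)

/-- The transition matrix `P^{(ν,G)}`. -/
noncomputable def Pmat {V : Type*} [Fintype V] [LinearOrder V]
    (G : SimpleGraph V) (ν : V → ℝ) : Matrix V V ℝ :=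
  Matrix.of fun l m =>
    if l = m then 1 - pconst G ν * denomP G ν l
    else if l < m ∧ G.Adj l m then pconst G ν
    else if m < l ∧ G.Adj l m then (ν m / ν l) * pconst G ν
    else 0

/-- A nonnegative matrix that is at least `δ` on the diagonal and along edges has powers
bounded below by powers of `δ` at the endpoints of every sufficiently short walk. -/
theorem pow_le_matrix_pow_of_walk {V : Type*} [Fintype V] [DecidableEq V] {G : SimpleGraph V}
    {A : Matrix V V ℝ} {δ : ℝ} (hδ : 0 ≤ δ) (hA : ∀ i j, 0 ≤ A i j)
    (hdiag : ∀ i, δ ≤ A i i) (hadj : ∀ i j, G.Adj i j → δ ≤ A i j) (n : ℕ) :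
    ∀ {i j : V} (w : G.Walk i j), w.length ≤ n → δ ^ n ≤ (A ^ n) i j := by
  have hpow : ∀ n i j, 0 ≤ (A ^ n) i j := by
    intro n
    induction n with
    | zero =>
      intro i j
      rw [pow_zero, Matrix.one_apply]
      split_ifs <;> norm_num
    | succ n ih =>
      intro i j
      rw [pow_succ, Matrix.mul_apply]
      exact sum_nonneg fun k _ => mul_nonneg (ih i k) (hA k j)
  have step : ∀ n i k j, δ ≤ A i k → δ ^ n ≤ (A ^ n) k j → δ ^ (n + 1) ≤ (A ^ (n + 1)) i j := by
    intro n i k j h1 h2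
    rw [pow_succ', pow_succ', Matrix.mul_apply]
    exact (mul_le_mul h1 h2 (pow_nonneg hδ n) (hA i k)).trans
      (single_le_sum (f := fun x => A i x * (A ^ n) x j)
        (fun x _ => mul_nonneg (hA i x) (hpow n x j)) (mem_univ k))
  induction n with
  | zero =>
    intro i j w hw
    cases w with
    | nil => simp
    | cons h w => simp at hw
  | succ n ih =>
    intro i j w hw
    cases w with
    | nil => exact step n i i i (hdiag i) (ih .nil (by simp))
    | cons h w => exact step n i _ j (hadj _ _ h) (ih w (by simpa using hw))

/-- Doeblin's contraction: a stochastic matrix with all entries at least `ε` contracts the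
`ℓ¹` norm of vectors with zero sum. -/
theorem sum_abs_vecMul_le {V : Type*} [Fintype V] [Nonempty V] {Q : Matrix V V ℝ} {ε : ℝ}
    (hε : 0 ≤ ε) (hQ : ∀ i j, ε ≤ Q i j) (hrow : ∀ i, ∑ j, Q i j = 1)
    {f : V → ℝ} (hf : ∑ i, f i = 0) :
    ∑ j, |Matrix.vecMul f Q j| ≤ (1 - ε) * ∑ i, |f i| := by
  have h1 : ∀ j, |Matrix.vecMul f Q j| ≤ ∑ i, |f i| * (Q i j - ε) := by
    intro j
    have : Matrix.vecMul f Q j = ∑ i, f i * (Q i j - ε) := by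
      simp only [Matrix.vecMul, dotProduct, mul_sub, sum_sub_distrib, ← sum_mul, hf]
      ring
    rw [this]
    refine (abs_sum_le_sum_abs _ _).trans (sum_le_sum fun i _ => ?_)
    rw [abs_mul, abs_of_nonneg (sub_nonneg.2 (hQ i j))]
  refine (sum_le_sum fun j _ => h1 j).trans ?_
  rw [sum_comm, mul_sum]
  refine sum_le_sum fun i _ => ?_
  rw [← mul_sum, sum_sub_distrib, hrow, mul_comm]
  refine mul_le_mul_of_nonneg_right ?_ (abs_nonneg _)
  have : (1 : ℝ) ≤ Fintype.card V := by exact_mod_cast Fintype.card_pos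
  simp only [sum_const, card_univ, nsmul_eq_mul]
  nlinarith

theorem sum_vecMul_of_row_sum {V : Type*} [Fintype V] {Q : Matrix V V ℝ}
    (hrow : ∀ i, ∑ j, Q i j = 1) (f : V → ℝ) :
    ∑ j, Matrix.vecMul f Q j = ∑ i, f i := by
  simp only [Matrix.vecMul, dotProduct]
  rw [sum_comm]
  simp [← mul_sum, hrow]

theorem sum_abs_vecMul_pow_le {V : Type*} [Fintype V] [DecidableEq V] [Nonempty V]
    {Q : Matrix V V ℝ} {ε : ℝ}
    (hε : 0 ≤ ε) (hε1 : ε ≤ 1) (hQ : ∀ i j, ε ≤ Q i j) (hrow : ∀ i, ∑ j, Q i j = 1)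
    {f : V → ℝ} (hf : ∑ i, f i = 0) (n : ℕ) :
    ∑ j, |Matrix.vecMul f (Q ^ n) j| ≤ (1 - ε) ^ n * ∑ i, |f i| := by
  induction n generalizing f with
  | zero => simp
  | succ n ih =>
    rw [pow_succ' Q, ← Matrix.vecMul_vecMul]
    refine (ih ((sum_vecMul_of_row_sum hrow f).trans hf)).trans ?_
    rw [pow_succ, mul_assoc]
    exact mul_le_mul_of_nonneg_left (sum_abs_vecMul_le hε hQ hrow hf)
      (pow_nonneg (sub_nonneg.2 hε1) n)

theorem row_sum_pow {V : Type*} [Fintype V] [DecidableEq V] {Q : Matrix V V ℝ}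
    (hrow : ∀ i, ∑ j, Q i j = 1) (n : ℕ) (i : V) : ∑ j, (Q ^ n) i j = 1 := by
  induction n generalizing i with
  | zero => simp [Matrix.one_apply]
  | succ n ih =>
    simp only [pow_succ, Matrix.mul_apply]
    rw [sum_comm]
    simp [← mul_sum, hrow, ih]

theorem vecMul_pow_of_stationary {V : Type*} [Fintype V] [DecidableEq V] {Q : Matrix V V ℝ} {ν : V → ℝ}
    (h : Matrix.vecMul ν Q = ν) (n : ℕ) : Matrix.vecMul ν (Q ^ n) = ν := by
  induction n with
  | zero => simp
  | succ n ih => rw [pow_succ, ← Matrix.vecMul_vecMul, ih, h]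

theorem tvDist_le_one {V : Type*} [Fintype V] {a b : V → ℝ} (ha : ∀ s, 0 ≤ a s)
    (hb : ∀ s, 0 ≤ b s) (ha1 : ∑ s, a s = 1) (hb1 : ∑ s, b s = 1) : tvDist a b ≤ 1 := by
  have h : ∑ s, |a s - b s| ≤ ∑ s, (a s + b s) := sum_le_sum fun s _ => by
    rw [abs_le]; constructor <;> linarith [ha s, hb s]
  rw [sum_add_distrib, ha1, hb1] at h
  unfold tvDist
  linarith

/-- Convergence in total variation along a stochastic matrix whose `d`-th power is bounded
below by `ε`. -/
theorem tvDist_vecMul_pow_le {V : Type*} [Fintype V] [DecidableEq V] [Nonempty V]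
    {P : Matrix V V ℝ} {ε : ℝ} {d q T : ℕ} (hε : 0 ≤ ε) (hε1 : ε ≤ 1) (hP : ∀ i j, 0 ≤ P i j)
    (hrow : ∀ i, ∑ j, P i j = 1) (hd : ∀ i j, ε ≤ (P ^ d) i j) (hT : d * q ≤ T)
    {ϑ ν : V → ℝ} (hν : Matrix.vecMul ν P = ν) (hϑ0 : ∀ s, 0 ≤ ϑ s) (hν0 : ∀ s, 0 ≤ ν s)
    (hϑ1 : ∑ s, ϑ s = 1) (hν1 : ∑ s, ν s = 1) :
    tvDist (Matrix.vecMul ϑ (P ^ T)) ν ≤ Real.exp (-(ε * q)) := by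
  obtain ⟨r, rfl⟩ := Nat.exists_eq_add_of_le hT
  have hf : ∑ i, (ϑ - ν) i = 0 := by simp [hϑ1, hν1]
  have hdrow := row_sum_pow hrow d
  have h1 := sum_abs_vecMul_pow_le hε hε1 hd hdrow hf q
  have h2 := sum_abs_vecMul_pow_le le_rfl zero_le_one hP hrow
    ((sum_vecMul_of_row_sum (row_sum_pow hdrow q) (ϑ - ν)).trans hf) r
  have h3 : tvDist (Matrix.vecMul ϑ (P ^ (d * q + r))) ν
      = (1 / 2) * ∑ j, |Matrix.vecMul (Matrix.vecMul (ϑ - ν) ((P ^ d) ^ q)) (P ^ r) j| := by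
    unfold tvDist
    rw [Matrix.vecMul_vecMul, ← pow_mul, ← pow_add, Matrix.sub_vecMul,
      vecMul_pow_of_stationary hν]
    rfl
  have h4 : (1 / 2) * ∑ i, |(ϑ - ν) i| ≤ 1 := tvDist_le_one hϑ0 hν0 hϑ1 hν1
  have h5 : (1 - ε) ^ q ≤ Real.exp (-(ε * q)) := by
    have := Real.one_sub_le_exp_neg ε
    calc (1 - ε) ^ q ≤ Real.exp (-ε) ^ q := pow_le_pow_left₀ (sub_nonneg.2 hε1) this q
      _ = Real.exp (-(ε * q)) := by rw [← Real.exp_nat_mul]; ring_nf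
  have h6 : (0 : ℝ) ≤ (1 - ε) ^ q := pow_nonneg (sub_nonneg.2 hε1) q
  rw [h3]
  rw [sub_zero, one_pow, one_mul] at h2
  nlinarith

section Pmat

variable {V : Type*} [Fintype V] [LinearOrder V] {G : SimpleGraph V} {ν : V → ℝ}

theorem denomP_pos [Nontrivial V] (hG : G.Connected) (hν : ∀ s, 0 < ν s) (l : V) :
    0 < denomP G ν l := by
  obtain ⟨m, hm⟩ := hG.preconnected.exists_adj_of_nontrivial l
  have h1 : ∀ m, (0 : ℝ) ≤ if l < m ∧ G.Adj l m then (1 : ℝ) else 0 := fun m => by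
    split_ifs <;> norm_num
  have h2 : ∀ m, (0 : ℝ) ≤ if m < l ∧ G.Adj l m then ν m / ν l else 0 := fun m => by
    split_ifs
    · exact (div_pos (hν m) (hν l)).le
    · exact le_rfl
  unfold denomP
  rcases lt_or_gt_of_ne hm.ne with h | h
  · refine add_pos_of_pos_of_nonneg (sum_pos' (fun m _ => h1 m) ⟨m, mem_univ m, ?_⟩)
      (sum_nonneg fun m _ => h2 m)
    rw [if_pos ⟨h, hm⟩]
    exact one_pos
  · refine add_pos_of_nonneg_of_pos (sum_nonneg fun m _ => h1 m)
      (sum_pos' (fun m _ => h2 m) ⟨m, mem_univ m, ?_⟩)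
    rw [if_pos ⟨h, hm⟩]
    exact div_pos (hν m) (hν l)

theorem denomP_le {C : ℝ} (hC1 : 1 ≤ C) (hC : ∀ l m, ν m / ν l ≤ C) (l : V) :
    denomP G ν l ≤ ((Fintype.card V : ℝ) - 1) * C := by
  have h : ∀ m, (if l < m ∧ G.Adj l m then (1 : ℝ) else 0)
      + (if m < l ∧ G.Adj l m then ν m / ν l else 0) ≤ if m = l then 0 else C := by
    intro m
    rcases lt_trichotomy l m with h | h | h
    · rw [if_neg (fun hh : m < l ∧ G.Adj l m => hh.1.not_gt h), if_neg h.ne']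
      split_ifs <;> linarith
    · simp [h]
    · rw [if_neg (fun hh : l < m ∧ G.Adj l m => hh.1.not_gt h), if_neg h.ne]
      split_ifs <;> linarith [hC l m]
  have hsum : ∑ m, (if m = l then 0 else C) = ((Fintype.card V : ℝ) - 1) * C := by
    have : ∀ m, (if m = l then 0 else C) = C - if m = l then C else 0 := fun m => by
      split_ifs <;> simp
    simp only [this, sum_sub_distrib, sum_ite_eq', mem_univ, if_true, sum_const, card_univ,
      nsmul_eq_mul]
    ring
  unfold denomP
  rw [← sum_add_distrib, ← hsum]
  exact sum_le_sum fun m _ => h m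

theorem pconst_mul_denomP_le {l : V} (h : 0 < denomP G ν l) :
    pconst G ν * denomP G ν l ≤ 1 / 2 := by
  have h1 : pconst G ν ≤ 1 / (2 * denomP G ν l) := ciInf_le (Set.finite_range _).bddBelow l
  calc pconst G ν * denomP G ν l ≤ 1 / (2 * denomP G ν l) * denomP G ν l :=
        mul_le_mul_of_nonneg_right h1 h.le
    _ = 1 / 2 := by field_simp

theorem le_pconst [Nonempty V] {D : ℝ} (hpos : ∀ l, 0 < denomP G ν l)
    (hD : ∀ l, denomP G ν l ≤ D) : 1 / (2 * D) ≤ pconst G ν :=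
  le_ciInf fun l => one_div_le_one_div_of_le (by linarith [hpos l]) (by linarith [hD l])

theorem Pmat_self (l : V) : Pmat G ν l l = 1 - pconst G ν * denomP G ν l := by
  simp [Pmat]

theorem Pmat_row_sum (l : V) : ∑ m, Pmat G ν l m = 1 := by
  have h : ∀ m, Pmat G ν l m = (if l = m then 1 - pconst G ν * denomP G ν l else 0)
      + pconst G ν * ((if l < m ∧ G.Adj l m then (1 : ℝ) else 0)
        + (if m < l ∧ G.Adj l m then ν m / ν l else 0)) := by
    intro m
    rcases lt_trichotomy l m with h | h | h
    · by_cases ha : G.Adj l m <;> simp [Pmat, h.ne, h, h.not_gt, ha]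
    · subst h; simp [Pmat]
    · by_cases ha : G.Adj l m <;> simp [Pmat, h.ne', h, h.not_gt, ha, mul_comm]
  simp only [h, sum_add_distrib, ← mul_sum, sum_ite_eq, mem_univ, if_true]
  unfold denomP
  ring

theorem Pmat_reversible (hν : ∀ s, 0 < ν s) (l m : V) :
    ν l * Pmat G ν l m = ν m * Pmat G ν m l := by
  have key : ∀ l m : V, l < m → ν l * Pmat G ν l m = ν m * Pmat G ν m l := by
    intro l m h
    have hm := (hν m).ne'
    by_cases ha : G.Adj l m
    · simp only [Pmat, Matrix.of_apply, h.ne, h.ne', h, h.not_gt, ha, ha.symm, and_self, if_true,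
        if_false, false_and]
      field_simp
    · have ha' : ¬ G.Adj m l := fun h => ha h.symm
      simp [Pmat, h.ne, h.ne', ha, ha']
  rcases lt_trichotomy l m with h | h | h
  · exact key l m h
  · rw [h]
  · exact (key m l h).symm

theorem Pmat_stationary (hν : ∀ s, 0 < ν s) : Matrix.vecMul ν (Pmat G ν) = ν := by
  ext m
  simp only [Matrix.vecMul, dotProduct]
  simp only [fun l => Pmat_reversible (G := G) hν l m, ← mul_sum, Pmat_row_sum, mul_one]

theorem pconst_le_Pmat (hν : ∀ s, 0 < ν s) (hanti : ∀ l m, l ≤ m → ν m ≤ ν l)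
    (hp : 0 ≤ pconst G ν) {l m : V} (h : G.Adj l m) : pconst G ν ≤ Pmat G ν l m := by
  rcases lt_or_gt_of_ne h.ne with hlm | hlm
  · simp [Pmat, hlm.ne, hlm, h]
  · have : 1 ≤ ν m / ν l := (one_le_div (hν l)).2 (hanti m l hlm.le)
    simp only [Pmat, Matrix.of_apply, hlm.ne', hlm, hlm.not_gt, h, and_self, if_true,
      if_false, false_and]
    exact le_mul_of_one_le_left hp this

theorem Pmat_nonneg (hν : ∀ s, 0 < ν s) (hp : 0 ≤ pconst G ν)
    (hdiag : ∀ l, 0 ≤ Pmat G ν l l) (l m : V) : 0 ≤ Pmat G ν l m := by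
  by_cases hlm : l = m
  · exact hlm ▸ hdiag l
  · simp only [Pmat, Matrix.of_apply, hlm, if_false]
    split_ifs
    · exact hp
    · exact mul_nonneg (div_pos (hν m) (hν l)).le hp
    · exact le_rfl

end Pmat

section muk

variable {N : ℕ} {μ : Fin N → ℝ} {ℓ : ℕ}

theorem one_le_sub_one_mul_of_suppMinCeil_lt (hℓ : suppMinCeil μ < ℓ) {s : Fin N}
    (hs : 0 < μ s) : 1 ≤ ((ℓ : ℝ) - 1) * μ s := by
  have hfin : (μ '' {s | 0 < μ s}).Finite := Set.toFinite _
  have hnonempty : (μ '' {s | 0 < μ s}).Nonempty := ⟨μ s, s, hs, rfl⟩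
  obtain ⟨t, ht, hts⟩ := hnonempty.csInf_mem hfin
  have hle : sInf (μ '' {s | 0 < μ s}) ≤ μ s := csInf_le hfin.bddBelow ⟨s, hs, rfl⟩
  have h1 : 1 / sInf (μ '' {s | 0 < μ s}) ≤ suppMinCeil μ := Nat.le_ceil _
  have h2 : (suppMinCeil μ : ℝ) + 1 ≤ ℓ := by exact_mod_cast hℓ
  have hpos : 0 < sInf (μ '' {s | 0 < μ s}) := hts ▸ ht
  have h3 : 1 / μ s ≤ 1 / sInf (μ '' {s | 0 < μ s}) := one_div_le_one_div_of_le hpos hle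
  rw [← div_le_iff₀ hs]
  linarith

theorem mem_Ak_iff (hμ0 : ∀ s, 0 ≤ μ s) (hℓ : suppMinCeil μ < ℓ) (s : Fin N) :
    s ∈ Ak μ ℓ ↔ μ s = 0 := by
  have hℓ0 : (0 : ℝ) < ℓ := by exact_mod_cast (Nat.zero_le _).trans_lt hℓ
  simp only [Ak, mem_filter, mem_univ, true_and]
  constructor
  · intro h
    by_contra hne
    have hs : 0 < μ s := lt_of_le_of_ne (hμ0 s) (Ne.symm hne)
    have := one_le_sub_one_mul_of_suppMinCeil_lt hℓ hs
    rw [lt_div_iff₀ hℓ0] at h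
    nlinarith
  · intro h
    rw [h]
    positivity

theorem muk_of_pos (hμ0 : ∀ s, 0 ≤ μ s) (hℓ : suppMinCeil μ < ℓ) {s : Fin N} (hs : 0 < μ s) :
    muk μ ℓ s = ((ℓ : ℝ) - 1) / ℓ * μ s := by
  simp [muk, etak, mem_Ak_iff hμ0 hℓ, hs.ne']

theorem muk_of_eq_zero (hμ0 : ∀ s, 0 ≤ μ s) (hℓ : suppMinCeil μ < ℓ) {s : Fin N}
    (hs : μ s = 0) : muk μ ℓ s = 1 / (ℓ : ℝ) * (1 / ((Ak μ ℓ).card : ℝ)) := by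
  simp [muk, etak, mem_Ak_iff hμ0 hℓ, hs]

theorem one_div_le_muk_of_pos (hμ0 : ∀ s, 0 ≤ μ s) (hℓ : suppMinCeil μ < ℓ) {s : Fin N}
    (hs : 0 < μ s) : 1 / (ℓ : ℝ) ≤ muk μ ℓ s := by
  have hℓ0 : (0 : ℝ) < ℓ := by exact_mod_cast (Nat.zero_le _).trans_lt hℓ
  rw [muk_of_pos hμ0 hℓ hs, div_mul_eq_mul_div]
  exact div_le_div_of_nonneg_right (one_le_sub_one_mul_of_suppMinCeil_lt hℓ hs) hℓ0.le

theorem muk_of_eq_zero_le (hμ0 : ∀ s, 0 ≤ μ s) (hℓ : suppMinCeil μ < ℓ) {s : Fin N}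
    (hs : μ s = 0) : muk μ ℓ s ≤ 1 / (ℓ : ℝ) := by
  have hcard : (1 : ℝ) ≤ (Ak μ ℓ).card := by
    exact_mod_cast card_pos.2 ⟨s, (mem_Ak_iff hμ0 hℓ s).2 hs⟩
  rw [muk_of_eq_zero hμ0 hℓ hs]
  exact mul_le_of_le_one_right (by positivity) ((div_le_one (by linarith)).2 hcard)

theorem muk_antitone (hμ0 : ∀ s, 0 ≤ μ s) (hord : ∀ l m : Fin N, l ≤ m → μ m ≤ μ l)
    (hℓ : suppMinCeil μ < ℓ) (l m : Fin N) (hlm : l ≤ m) : muk μ ℓ m ≤ muk μ ℓ l := by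
  have hℓ0 : (1 : ℝ) ≤ ℓ := by exact_mod_cast (Nat.zero_le _).trans_lt hℓ
  rcases (hμ0 m).eq_or_lt with hm | hm
  · rcases (hμ0 l).eq_or_lt with hl | hl
    · rw [muk_of_eq_zero hμ0 hℓ hm.symm, muk_of_eq_zero hμ0 hℓ hl.symm]
    · exact (muk_of_eq_zero_le hμ0 hℓ hm.symm).trans (one_div_le_muk_of_pos hμ0 hℓ hl)
  · rw [muk_of_pos hμ0 hℓ hm, muk_of_pos hμ0 hℓ (hm.trans_le (hord l m hlm))]
    exact mul_le_mul_of_nonneg_left (hord l m hlm) (div_nonneg (by linarith) (by linarith))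

theorem le_muk (hN : 2 ≤ N) (hμ0 : ∀ s, 0 ≤ μ s) (hμ1 : ∑ s, μ s = 1)
    (hℓ : suppMinCeil μ < ℓ) (s : Fin N) : 1 / ((ℓ : ℝ) * ((N : ℝ) - 1)) ≤ muk μ ℓ s := by
  have hℓ0 : (0 : ℝ) < ℓ := by exact_mod_cast (Nat.zero_le _).trans_lt hℓ
  have hN' : (2 : ℝ) ≤ N := by exact_mod_cast hN
  rcases (hμ0 s).eq_or_lt with hs | hs
  · have hpos : 0 < (Ak μ ℓ).card := card_pos.2 ⟨s, (mem_Ak_iff hμ0 hℓ s).2 hs.symm⟩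
    have hlt : (Ak μ ℓ).card < N := by
      obtain ⟨t, -, ht⟩ := exists_ne_zero_of_sum_ne_zero (hμ1.trans_ne one_ne_zero)
      have : Ak μ ℓ ⊂ univ := (ssubset_univ_iff).2 fun h =>
        ht ((mem_Ak_iff hμ0 hℓ t).1 (h ▸ mem_univ t))
      simpa using card_lt_card this
    have hpos' : (0 : ℝ) < (Ak μ ℓ).card := by exact_mod_cast hpos
    have hlt' : ((Ak μ ℓ).card : ℝ) + 1 ≤ N := by exact_mod_cast hlt
    rw [muk_of_eq_zero hμ0 hℓ hs.symm, one_div_mul_one_div]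
    exact one_div_le_one_div_of_le (by positivity)
      (mul_le_mul_of_nonneg_left (by linarith) hℓ0.le)
  · refine le_trans ?_ (one_div_le_muk_of_pos hμ0 hℓ hs)
    exact one_div_le_one_div_of_le hℓ0 (le_mul_of_one_le_right hℓ0.le (by linarith))

theorem sum_muk (hμ0 : ∀ s, 0 ≤ μ s) (hμ1 : ∑ s, μ s = 1)
    (hne : {s : Fin N | 0 < μ s} ≠ Set.univ) (hℓ : suppMinCeil μ < ℓ) :
    ∑ s, muk μ ℓ s = 1 := by
  have hℓ0 : (0 : ℝ) < ℓ := by exact_mod_cast (Nat.zero_le _).trans_lt hℓ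
  obtain ⟨t, ht⟩ := (Set.ne_univ_iff_exists_notMem _).1 hne
  have ht0 : μ t = 0 := le_antisymm (not_lt.1 ht) (hμ0 t)
  have hcard : ((Ak μ ℓ).card : ℝ) ≠ 0 := by
    exact_mod_cast (card_pos.2 ⟨t, (mem_Ak_iff hμ0 hℓ t).2 ht0⟩).ne'
  have heta : ∑ s, etak μ ℓ s = 1 := by
    simp only [etak, ← sum_filter, filter_mem_eq_inter, univ_inter, sum_const, nsmul_eq_mul]
    field_simp
  simp only [muk, sum_add_distrib, ← mul_sum, heta, hμ1]
  field_simp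
  ring

end muk

theorem stmt_9 {N : ℕ} (hN : 3 ≤ N) (G : SimpleGraph (Fin N)) (hG : G.Connected)
    (μ : Fin N → ℝ) (hμ0 : ∀ s, 0 ≤ μ s) (hμ1 : ∑ s, μ s = 1)
    (hord : ∀ l m : Fin N, l ≤ m → μ m ≤ μ l)
    (hsupp : ¬ (G.induce {s : Fin N | 0 < μ s}).Connected)
    (hne : {s : Fin N | 0 < μ s} ≠ Set.univ)
    (cN : ℝ) (hcN : cN = 1 / (2 * ((N : ℝ) - 1) ^ 2))
    (ℓ : ℕ) (hℓ : suppMinCeil μ < ℓ)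
    (ϑ : Fin N → ℝ) (hϑ0 : ∀ s, 0 ≤ ϑ s) (hϑ1 : ∑ s, ϑ s = 1) :
    tvDist (Matrix.vecMul ϑ ((Pmat G (muk μ ℓ)) ^ (ℓ ^ (2 * N)))) (muk μ ℓ)
      ≤ Real.exp (-(cN ^ (N - 1)) * ((ℓ ^ (N + 1) / (N - 1) : ℕ) : ℝ)) := by
  have hℓ1 : (1 : ℝ) ≤ ℓ := by exact_mod_cast (Nat.zero_le _).trans_lt hℓ
  have hN' : (3 : ℝ) ≤ N := by exact_mod_cast hN
  have : Nontrivial (Fin N) := Fin.nontrivial_iff_two_le.2 (by omega)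
  have hlow := le_muk (by omega) hμ0 hμ1 hℓ
  have hC1 : 1 ≤ (ℓ : ℝ) * ((N : ℝ) - 1) := by nlinarith
  have hpos : ∀ s, 0 < muk μ ℓ s := fun s => (one_div_pos.2 (by linarith)).trans_le (hlow s)
  have hsum := sum_muk hμ0 hμ1 hne hℓ
  have hratio : ∀ l m, muk μ ℓ m / muk μ ℓ l ≤ (ℓ : ℝ) * ((N : ℝ) - 1) := by
    intro l m
    have h1 : muk μ ℓ m ≤ 1 :=
      hsum ▸ single_le_sum (fun s _ => (hpos s).le) (mem_univ m)
    have h2 := hlow l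
    rw [div_le_iff₀ (by linarith)] at h2
    rw [div_le_iff₀ (hpos l)]
    linarith
  have hden := denomP_pos hG hpos
  have hδ : cN / ℓ = 1 / (2 * (((N : ℝ) - 1) * (ℓ * ((N : ℝ) - 1)))) := by
    rw [hcN, div_div]
    ring_nf
  have hδp : cN / ℓ ≤ pconst G (muk μ ℓ) := by
    have h := le_pconst hden (denomP_le (G := G) hC1 hratio)
    rwa [Fintype.card_fin, ← hδ] at h
  have hδ0 : 0 < cN / ℓ := hδ ▸ one_div_pos.2 (mul_pos two_pos (mul_pos (by linarith)
    (by linarith)))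
  have hδ1 : cN / ℓ ≤ 1 / 2 := by
    rw [hδ]
    exact one_div_le_one_div_of_le two_pos (by nlinarith)
  have hdiag : ∀ l, cN / ℓ ≤ Pmat G (muk μ ℓ) l l := fun l => by
    rw [Pmat_self]
    linarith [pconst_mul_denomP_le (hden l)]
  have hp := hδ0.le.trans hδp
  have hP := Pmat_nonneg hpos hp fun l => hδ0.le.trans (hdiag l)
  have hpow : ∀ i j, (cN / ℓ) ^ (N - 1) ≤ (Pmat G (muk μ ℓ) ^ (N - 1)) i j := by
    intro i j
    obtain ⟨w, hw⟩ := hG.exists_isPath i j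
    have hlen := hw.length_lt
    rw [Fintype.card_fin] at hlen
    exact pow_le_matrix_pow_of_walk hδ0.le hP hdiag
      (fun l m h => hδp.trans (pconst_le_Pmat hpos (muk_antitone hμ0 hord hℓ) hp h))
      (N - 1) w (by omega)
  have hT : (N - 1) * (ℓ ^ (N - 1) * (ℓ ^ (N + 1) / (N - 1))) ≤ ℓ ^ (2 * N) := by
    calc (N - 1) * (ℓ ^ (N - 1) * (ℓ ^ (N + 1) / (N - 1)))
        = ℓ ^ (N - 1) * ((N - 1) * (ℓ ^ (N + 1) / (N - 1))) := by ring
      _ ≤ ℓ ^ (N - 1) * ℓ ^ (N + 1) := Nat.mul_le_mul_left _ (Nat.mul_div_le _ _)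
      _ = ℓ ^ (2 * N) := by rw [← pow_add]; congr 1; omega
  refine (tvDist_vecMul_pow_le (pow_nonneg hδ0.le _) (pow_le_one₀ hδ0.le (by linarith)) hP
    Pmat_row_sum hpow hT (Pmat_stationary hpos) hϑ0 (fun s => (hpos s).le) hϑ1 hsum).trans
    (le_of_eq ?_)
  congr 1
  have : (ℓ : ℝ) ^ (N - 1) ≠ 0 := pow_ne_zero _ (by linarith)
  rw [div_pow, Nat.cast_mul, Nat.cast_pow]
  field_simp
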